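/- arXiv:1511.07363 — 5 statements merged into one kernel-verified Lean document; each statement's English description precedes it below -/
import Mathlib

section
/- Let $G$ be a finite group, let $U$ be a $G$-universe, and let $T$ be a nonempty finite $G$-set. Equip the orthogonal direct sum $\mathbb{R}\{T\}\otimes U := \bigoplus_{t\in T} U$ with the $G$-action $(g\cdot u)_t = g\cdot u_{g^{-1}t}$, which is an action by linear isometries. If there exists a $G$-equivariant real-linear isometric embedding $\bigoplus_{t\in T} U \to U$, then there exists a $G$-equivariant real-linear isometric isomorphism (i.e., a surjective linear isometry) $\bigoplus_{t\in T} U \to U$. -/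
/-- A `G`-universe: a real inner product space of countably infinite dimension with an
action of `G` by linear isometries, containing a nonzero fixed vector, and such that every
finite-dimensional invariant subspace admits `n` pairwise orthogonal equivariantly
isometrically isomorphic invariant copies for every `n`. -/
structure IsGUniverse (G : Type*) [Group G] {U : Type*} [NormedAddCommGroup U]
    [InnerProductSpace ℝ U] (ρ : G →* (U ≃ₗᵢ[ℝ] U)) : Prop where
  rank_eq : Module.rank ℝ U = Cardinal.aleph0
  exists_fixed : ∃ u : U, u ≠ 0 ∧ ∀ g : G, ρ g u = u
  exists_copies : ∀ V : Submodule ℝ U, FiniteDimensional ℝ V →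
    (∀ g : G, ∀ v ∈ V, ρ g v ∈ V) →
    ∀ n : ℕ, ∃ W : Fin n → Submodule ℝ U,
      (∀ i j, i ≠ j → ∀ x ∈ W i, ∀ y ∈ W j, inner ℝ x y = (0 : ℝ)) ∧
      (∀ i, ∀ g : G, ∀ w ∈ W i, ρ g w ∈ W i) ∧
      (∀ i, ∃ e : V ≃ₗᵢ[ℝ] (W i), ∀ (g : G) (v v' : V),
        (v' : U) = ρ g (v : U) → ((e v' : U) = ρ g (e v : U)))

namespace UnivAux

variable {G : Type*} [Group G] {X Y : Type*} [NormedAddCommGroup X] [InnerProductSpace ℝ X]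
  [NormedAddCommGroup Y] [InnerProductSpace ℝ Y]

/-- Every finite-dimensional invariant subspace of `X` has `n` orthogonal copies in `Y`. -/
def HasCopies (ρ : Representation ℝ G X) (σ : Representation ℝ G Y) : Prop :=
  ∀ C : Submodule ℝ X, FiniteDimensional ℝ C → (∀ g : G, ∀ v ∈ C, ρ g v ∈ C) → ∀ n : ℕ,
    ∃ e : Fin n → (C →ₗ[ℝ] Y), (∀ i v, ‖e i v‖ = ‖v‖) ∧
      (∀ i j, i ≠ j → ∀ v w, inner ℝ (e i v) (e j w) = (0 : ℝ)) ∧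
      (∀ i g (v v' : C), (v' : X) = ρ g v → e i v' = σ g (e i v))

/-- A copy orthogonal to a given finite-dimensional subspace. -/
theorem exists_orth (ρ : Representation ℝ G X) (σ : Representation ℝ G Y)
    (h : HasCopies ρ σ) (C : Submodule ℝ X) [FiniteDimensional ℝ C]
    (hC : ∀ g : G, ∀ v ∈ C, ρ g v ∈ C) (B : Submodule ℝ Y) [FiniteDimensional ℝ B] :
    ∃ e : C →ₗ[ℝ] Y, (∀ v, ‖e v‖ = ‖v‖) ∧ (∀ v, e v ∈ Bᗮ) ∧
      (∀ g (v v' : C), (v' : X) = ρ g v → e v' = σ g (e v)) := by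
  obtain ⟨e, he1, he2, he3⟩ := h C inferInstance hC (Module.finrank ℝ (C →ₗ[ℝ] B) + 1)
  let P : Fin (Module.finrank ℝ (C →ₗ[ℝ] B) + 1) → (C →ₗ[ℝ] B) :=
    fun i => (B.orthogonalProjectionOnto : Y →ₗ[ℝ] B) ∘ₗ e i
  have hP : ¬ LinearIndependent ℝ P := by
    intro hl
    have := hl.fintype_card_le_finrank
    simp at this
  obtain ⟨c, hc0, i0, hi0⟩ := Fintype.not_linearIndependent_iff.1 hP
  have hs : 0 < ∑ i, c i ^ 2 :=
    Finset.sum_pos' (fun i _ => sq_nonneg _) ⟨i0, Finset.mem_univ _, by positivity⟩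
  set s := ∑ i, c i ^ 2 with hsdef
  have hsum : ∀ v, ‖∑ i, c i • e i v‖ ^ 2 = s * ‖v‖ ^ 2 := by
    intro v
    rw [← real_inner_self_eq_norm_sq, sum_inner]
    rw [hsdef, Finset.sum_mul]
    refine Finset.sum_congr rfl fun i _ => ?_
    rw [inner_sum, Finset.sum_eq_single i]
    · rw [real_inner_smul_left, real_inner_smul_right, real_inner_self_eq_norm_sq, he1]
      ring
    · intro j _ hj
      rw [real_inner_smul_left, real_inner_smul_right, he2 i j (Ne.symm hj)]
      simp
    · simp
  refine ⟨(Real.sqrt s)⁻¹ • ∑ i, c i • e i, ?_, ?_, ?_⟩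
  · intro v
    have h1 := hsum v
    have hss : 0 < Real.sqrt s := Real.sqrt_pos.2 hs
    have h2 : ‖∑ i, c i • e i v‖ = Real.sqrt s * ‖v‖ := by
      rw [← sq_eq_sq₀ (norm_nonneg _) (by positivity), h1, mul_pow, Real.sq_sqrt hs.le]
    simp only [LinearMap.smul_apply, LinearMap.sum_apply, norm_smul, h2, norm_inv,
      Real.norm_eq_abs, abs_of_pos hss]
    field_simp
  · intro v
    simp only [LinearMap.smul_apply, LinearMap.sum_apply]
    refine Submodule.smul_mem _ _ ?_
    rw [← Submodule.orthogonalProjectionOnto_eq_zero_iff]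
    have := congrArg (fun f : C →ₗ[ℝ] B => f v) hc0
    simpa [P, LinearMap.sum_apply] using this
  · intro g v w hvw
    simp only [LinearMap.smul_apply, LinearMap.sum_apply, map_smul, map_sum]
    simp only [he3 _ g v w hvw]

/-- Finite partial equivariant isometries, as graphs. -/
def IsPart (ρ : Representation ℝ G X) (σ : Representation ℝ G Y)
    (Γ : Submodule ℝ (X × Y)) : Prop :=
  FiniteDimensional ℝ Γ ∧ (∀ g : G, ∀ p ∈ Γ, (ρ g p.1, σ g p.2) ∈ Γ) ∧ ∀ p ∈ Γ, ‖p.1‖ = ‖p.2‖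

theorem IsPart.swap {ρ : Representation ℝ G X} {σ : Representation ℝ G Y}
    {Γ : Submodule ℝ (X × Y)} (h : IsPart ρ σ Γ) :
    IsPart σ ρ (Γ.map (LinearEquiv.prodComm ℝ X Y : X × Y →ₗ[ℝ] Y × X)) := by
  obtain ⟨h1, h2, h3⟩ := h
  refine ⟨inferInstance, ?_, ?_⟩
  · rintro g _ ⟨p, hp, rfl⟩
    exact ⟨_, h2 g p hp, rfl⟩
  · rintro _ ⟨p, hp, rfl⟩
    exact (h3 p hp).symm

theorem inner_rep (ρ : Representation ℝ G X) (hρ : ∀ g x, ‖ρ g x‖ = ‖x‖) (g : G) (x y : X) :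
    inner ℝ (ρ g x) (ρ g y) = inner ℝ x y :=
  LinearIsometry.inner_map_map (⟨ρ g, hρ g⟩ : X →ₗᵢ[ℝ] X) x y

theorem extend [Finite G] (ρ : Representation ℝ G X) (σ : Representation ℝ G Y)
    (hρ : ∀ g x, ‖ρ g x‖ = ‖x‖)
    (h : HasCopies ρ σ) (Γ : Submodule ℝ (X × Y)) (hΓ : IsPart ρ σ Γ) (x : X) :
    ∃ Γ', IsPart ρ σ Γ' ∧ Γ ≤ Γ' ∧ ∃ y, (x, y) ∈ Γ' := by
  obtain ⟨h1, h2, h3⟩ := hΓ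
  let A := Γ.map (LinearMap.fst ℝ X Y)
  let B := Γ.map (LinearMap.snd ℝ X Y)
  have hAinv : ∀ g : G, ∀ v ∈ A, ρ g v ∈ A := by
    rintro g _ ⟨p, hp, rfl⟩
    exact ⟨_, h2 g p hp, rfl⟩
  obtain ⟨a, ha, x', hx', hax⟩ : ∃ a ∈ A, ∃ x' ∈ Aᗮ, x = a + x' :=
    Submodule.exists_add_mem_mem_orthogonal x
  have hAo : ∀ g : G, ρ g x' ∈ Aᗮ := by
    intro g
    rw [Submodule.mem_orthogonal]
    intro u hu
    have := inner_rep ρ hρ g (ρ g⁻¹ u) x'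
    rw [← Module.End.mul_apply, ← map_mul, mul_inv_cancel, map_one, Module.End.one_apply] at this
    rw [this]
    exact (Submodule.mem_orthogonal _ _).1 hx' _ (hAinv _ _ hu)
  let C : Submodule ℝ X := Submodule.span ℝ (Set.range fun g : G => ρ g x')
  have hCA : C ≤ Aᗮ := by
    rw [Submodule.span_le]
    rintro _ ⟨g, rfl⟩
    exact hAo g
  have hCinv : ∀ g : G, ∀ v ∈ C, ρ g v ∈ C := by
    intro g v hv
    have : C ≤ C.comap (ρ g) := by
      rw [Submodule.span_le]
      rintro _ ⟨k, rfl⟩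
      refine Submodule.subset_span ⟨g * k, ?_⟩
      simp
    exact this hv
  have hxC : x' ∈ C := Submodule.subset_span ⟨1, by simp⟩
  have : FiniteDimensional ℝ C := FiniteDimensional.span_of_finite ℝ (Set.finite_range _)
  obtain ⟨e, he1, he2, he3⟩ := exists_orth ρ σ h C hCinv B
  refine ⟨Γ ⊔ LinearMap.range (C.subtype.prod e), ⟨inferInstance, ?_, ?_⟩, le_sup_left, ?_⟩
  · intro g p hp
    obtain ⟨q, hq, _, ⟨c, rfl⟩, rfl⟩ := Submodule.mem_sup.1 hp
    refine Submodule.mem_sup.2 ⟨_, h2 g q hq, _, ⟨⟨ρ g c, hCinv g c c.2⟩, rfl⟩, ?_⟩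
    simp [he3 g c ⟨ρ g c, hCinv g c c.2⟩ rfl]
  · intro p hp
    obtain ⟨q, hq, _, ⟨c, rfl⟩, rfl⟩ := Submodule.mem_sup.1 hp
    have o1 : inner ℝ q.1 (c : X) = (0 : ℝ) :=
      (Submodule.mem_orthogonal _ _).1 (hCA c.2) _ ⟨q, hq, rfl⟩
    have o2 : inner ℝ q.2 (e c) = (0 : ℝ) :=
      (Submodule.mem_orthogonal _ _).1 (he2 c) _ ⟨q, hq, rfl⟩
    have n1 := norm_add_sq_eq_norm_sq_add_norm_sq_real o1
    have n2 := norm_add_sq_eq_norm_sq_add_norm_sq_real o2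
    rw [← h3 q hq, he1, ← Submodule.norm_coe, ← n1] at n2
    exact ((mul_self_inj (norm_nonneg _) (norm_nonneg _)).1 n2).symm
  · obtain ⟨q, hq, hqa⟩ := ha
    refine ⟨q.2 + e ⟨x', hxC⟩, Submodule.mem_sup.2 ⟨q, hq, _, ⟨⟨x', hxC⟩, rfl⟩, ?_⟩⟩
    ext
    · simpa [hax] using hqa
    · simp

theorem extend' [Finite G] (ρ : Representation ℝ G X) (σ : Representation ℝ G Y)
    (hσ : ∀ g x, ‖σ g x‖ = ‖x‖)
    (h : HasCopies σ ρ) (Γ : Submodule ℝ (X × Y)) (hΓ : IsPart ρ σ Γ) (y : Y) :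
    ∃ Γ', IsPart ρ σ Γ' ∧ Γ ≤ Γ' ∧ ∃ x, (x, y) ∈ Γ' := by
  obtain ⟨Γ', a, b, x, c⟩ := extend σ ρ hσ h _ hΓ.swap y
  refine ⟨_, a.swap, ?_, x, ⟨_, c, rfl⟩⟩
  intro p hp
  exact ⟨(p.2, p.1), b ⟨p, hp, rfl⟩, rfl⟩

theorem main [Finite G] (ρ : Representation ℝ G X) (σ : Representation ℝ G Y)
    (hρ : ∀ g x, ‖ρ g x‖ = ‖x‖) (hσ : ∀ g x, ‖σ g x‖ = ‖x‖)
    (h : HasCopies ρ σ) (h' : HasCopies σ ρ)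
    {ι κ : Type*} [Countable ι] [Countable κ] (b : ι → X) (c : κ → Y)
    (hb : Submodule.span ℝ (Set.range b) = ⊤) (hc : Submodule.span ℝ (Set.range c) = ⊤) :
    ∃ e : X ≃ₗᵢ[ℝ] Y, ∀ g x, e (ρ g x) = σ g (e x) := by
  let P := {Γ : Submodule ℝ (X × Y) // IsPart ρ σ Γ}
  let D : ι ⊕ κ → Order.Cofinal P := fun s => match s with
    | Sum.inl i => ⟨{Γ | ∃ y, (b i, y) ∈ Γ.1}, fun Γ => by
        obtain ⟨Γ', h1, h2, h3⟩ := extend ρ σ hρ h Γ.1 Γ.2 (b i)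
        exact ⟨⟨Γ', h1⟩, h3, h2⟩⟩
    | Sum.inr i => ⟨{Γ | ∃ x, (x, c i) ∈ Γ.1}, fun Γ => by
        obtain ⟨Γ', h1, h2, h3⟩ := extend' ρ σ hσ h' Γ.1 Γ.2 (c i)
        exact ⟨⟨Γ', h1⟩, h3, h2⟩⟩
  have : Encodable (ι ⊕ κ) := Encodable.ofCountable _
  let p0 : P := ⟨⊥, inferInstance, by
    intro g p hp
    rw [Submodule.mem_bot] at hp
    simp [hp], by
    intro p hp
    rw [Submodule.mem_bot] at hp
    simp [hp]⟩
  let I := Order.idealOfCofinals p0 D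
  let S : I → Submodule ℝ (X × Y) := fun Γ => Γ.1.1
  have hdir : Directed (· ≤ ·) S := by
    intro u v
    obtain ⟨w, hw, h1, h2⟩ := I.directed u.1 u.2 v.1 v.2
    exact ⟨⟨w, hw⟩, h1, h2⟩
  have : Nonempty I := ⟨⟨p0, Order.mem_idealOfCofinals p0 D⟩⟩
  let Γ : Submodule ℝ (X × Y) := ⨆ i, S i
  have hmem : ∀ p, p ∈ Γ ↔ ∃ i, p ∈ S i := fun p => Submodule.mem_iSup_of_directed S hdir
  have hnorm : ∀ p ∈ Γ, ‖p.1‖ = ‖p.2‖ := by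
    intro p hp
    obtain ⟨i, hi⟩ := (hmem p).1 hp
    exact i.1.2.2.2 p hi
  have hinv : ∀ g : G, ∀ p ∈ Γ, (ρ g p.1, σ g p.2) ∈ Γ := by
    intro g p hp
    obtain ⟨i, hi⟩ := (hmem p).1 hp
    exact (hmem _).2 ⟨i, i.1.2.2.1 g p hi⟩
  have hfst : Γ.map (LinearMap.fst ℝ X Y) = ⊤ := by
    rw [eq_top_iff, ← hb, Submodule.span_le]
    rintro _ ⟨i, rfl⟩
    obtain ⟨Δ, ⟨y, hy⟩, hΔ⟩ := Order.cofinal_meets_idealOfCofinals p0 D (Sum.inl i)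
    exact ⟨(b i, y), (hmem _).2 ⟨⟨Δ, hΔ⟩, hy⟩, rfl⟩
  have hsnd : Γ.map (LinearMap.snd ℝ X Y) = ⊤ := by
    rw [eq_top_iff, ← hc, Submodule.span_le]
    rintro _ ⟨i, rfl⟩
    obtain ⟨Δ, ⟨y, hy⟩, hΔ⟩ := Order.cofinal_meets_idealOfCofinals p0 D (Sum.inr i)
    exact ⟨(y, c i), (hmem _).2 ⟨⟨Δ, hΔ⟩, hy⟩, rfl⟩
  let F1 : Γ →ₗ[ℝ] X := LinearMap.fst ℝ X Y ∘ₗ Γ.subtype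
  let F2 : Γ →ₗ[ℝ] Y := LinearMap.snd ℝ X Y ∘ₗ Γ.subtype
  have hF : ∀ p, ‖F1 p‖ = ‖F2 p‖ := fun p => hnorm p.1 p.2
  have key : ∀ p : Γ, F1 p = 0 ∨ F2 p = 0 → p = 0 := by
    intro p hp
    have hn := hF p
    have h12 : F1 p = 0 ∧ F2 p = 0 := by
      rcases hp with hp | hp
      · rw [hp, norm_zero] at hn
        exact ⟨hp, norm_eq_zero.1 hn.symm⟩
      · rw [hp, norm_zero] at hn
        exact ⟨norm_eq_zero.1 hn, hp⟩
    exact Subtype.ext (Prod.ext h12.1 h12.2)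
  have b1 : Function.Bijective F1 := by
    refine ⟨(injective_iff_map_eq_zero F1).2 fun p hp => key p (Or.inl hp), fun x => ?_⟩
    obtain ⟨p, hp, hpx⟩ : x ∈ Γ.map (LinearMap.fst ℝ X Y) := hfst ▸ Submodule.mem_top
    exact ⟨⟨p, hp⟩, hpx⟩
  have b2 : Function.Bijective F2 := by
    refine ⟨(injective_iff_map_eq_zero F2).2 fun p hp => key p (Or.inr hp), fun x => ?_⟩
    obtain ⟨p, hp, hpx⟩ : x ∈ Γ.map (LinearMap.snd ℝ X Y) := hsnd ▸ Submodule.mem_top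
    exact ⟨⟨p, hp⟩, hpx⟩
  let E1 := LinearEquiv.ofBijective F1 b1
  let E2 := LinearEquiv.ofBijective F2 b2
  have hE : ∀ p : Γ, (E1.symm.trans E2) (F1 p) = F2 p := by
    intro p
    have : E1.symm (F1 p) = p := E1.symm_apply_apply p
    rw [LinearEquiv.trans_apply, this]
    rfl
  refine ⟨⟨E1.symm.trans E2, ?_⟩, ?_⟩
  · intro x
    obtain ⟨p, rfl⟩ := b1.2 x
    rw [hE, hF]
  · intro g x
    obtain ⟨p, rfl⟩ := b1.2 x
    change (E1.symm.trans E2) (ρ g (F1 p)) = σ g ((E1.symm.trans E2) (F1 p))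
    rw [hE]
    exact hE ⟨_, hinv g p.1 p.2⟩

/-- Transport of copies along equivariant isometric embeddings `X → Z`, `W → Y`. -/
theorem HasCopies.of_left {Z : Type*} [NormedAddCommGroup Z] [InnerProductSpace ℝ Z]
    {ρ : Representation ℝ G X} {σ : Representation ℝ G Y} {τ : Representation ℝ G Z}
    (h : HasCopies τ σ) (f : X →ₗᵢ[ℝ] Z) (hf : ∀ g x, f (ρ g x) = τ g (f x)) :
    HasCopies ρ σ := by
  intro C hC hinv n
  let C' := C.map f.toLinearMap
  obtain ⟨e, h1, h2, h3⟩ := h C' inferInstance (by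
    rintro g _ ⟨v, hv, rfl⟩
    exact ⟨_, hinv g v hv, hf g v⟩) n
  let r : C →ₗ[ℝ] C' := (f.toLinearMap ∘ₗ C.subtype).codRestrict C' fun v => ⟨v, v.2, rfl⟩
  refine ⟨fun i => e i ∘ₗ r, ?_, ?_, ?_⟩
  · intro i v
    rw [LinearMap.comp_apply, h1]
    exact f.norm_map v
  · intro i j hij v w
    exact h2 i j hij _ _
  · intro i g v v' hv
    refine h3 i g (r v) (r v') ?_
    change f v' = τ g (f v)
    rw [hv, hf]

theorem HasCopies.of_right {Z : Type*} [NormedAddCommGroup Z] [InnerProductSpace ℝ Z]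
    {ρ : Representation ℝ G X} {σ : Representation ℝ G Y} {τ : Representation ℝ G Z}
    (h : HasCopies ρ τ) (f : Z →ₗᵢ[ℝ] Y) (hf : ∀ g x, f (τ g x) = σ g (f x)) :
    HasCopies ρ σ := by
  intro C hC hinv n
  obtain ⟨e, h1, h2, h3⟩ := h C hC hinv n
  refine ⟨fun i => f.toLinearMap ∘ₗ e i, ?_, ?_, ?_⟩
  · intro i v
    rw [← h1 i v]
    exact f.norm_map _
  · intro i j hij v w
    rw [← h2 i j hij v w]
    exact f.inner_map_map _ _
  · intro i g v v' hv
    change f (e i v') = σ g (f (e i v))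
    rw [h3 i g v v' hv, hf]

end UnivAux

/-- If `T` is a nonempty finite `G`-set and there is a `G`-equivariant linear isometric
embedding `ℝ{T} ⊗ U = ⊕_{t ∈ T} U → U` (for the action `(g • u)_t = g • u_{g⁻¹ t}`), then
there is a `G`-equivariant linear isometric isomorphism `⊕_{t ∈ T} U → U`. -/
theorem exists_equivariant_isometryEquiv_of_embedding (G : Type*) [Group G] [Finite G]
    {U : Type*} [NormedAddCommGroup U] [InnerProductSpace ℝ U]
    (ρ : G →* (U ≃ₗᵢ[ℝ] U)) (hU : IsGUniverse G ρ)
    (T : Type*) [Fintype T] [Nonempty T] [MulAction G T]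
    (hemb : ∃ f : PiLp 2 (fun _ : T => U) →ₗᵢ[ℝ] U,
      ∀ (g : G) (x : PiLp 2 fun _ : T => U),
        f (WithLp.toLp 2 (fun t => ρ g (x (g⁻¹ • t)))) = ρ g (f x)) :
    ∃ e : PiLp 2 (fun _ : T => U) ≃ₗᵢ[ℝ] U,
      ∀ (g : G) (x : PiLp 2 fun _ : T => U),
        e (WithLp.toLp 2 (fun t => ρ g (x (g⁻¹ • t)))) = ρ g (e x) := by
  classical
  obtain ⟨f, hf⟩ := hemb
  let σ : Representation ℝ G U :=
    { toFun := fun g => (ρ g).toLinearEquiv.toLinearMap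
      map_one' := by ext; simp
      map_mul' := fun a b => by ext; simp }
  let τ : Representation ℝ G (PiLp 2 (fun _ : T => U)) :=
    { toFun := fun g =>
        { toFun := fun x => WithLp.toLp 2 (fun t => ρ g (x (g⁻¹ • t)))
          map_add' := fun x y => by ext t; simp
          map_smul' := fun r x => by ext t; simp }
      map_one' := by ext; simp
      map_mul' := fun a b => by ext; simp [mul_smul] }
  have hσ : ∀ g x, ‖σ g x‖ = ‖x‖ := fun g x => (ρ g).norm_map x
  have hfτ : ∀ g x, f (τ g x) = σ g (f x) := hf
  have hτ : ∀ g x, ‖τ g x‖ = ‖x‖ := fun g x => by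
    rw [← f.norm_map, hfτ, hσ, f.norm_map]
  have hcop : UnivAux.HasCopies σ σ := by
    intro C hC hinv n
    obtain ⟨W, h1, h2, h3⟩ := hU.exists_copies C hC hinv n
    choose e he using h3
    refine ⟨fun i => (W i).subtype ∘ₗ (e i).toLinearEquiv.toLinearMap, ?_, ?_, ?_⟩
    · intro i v
      exact (e i).norm_map v
    · intro i j hij v w
      exact h1 i j hij _ (e i v).2 _ (e j w).2
    · intro i g v v' hv
      exact he i g v v' hv
  have hT : (0 : ℝ) < Fintype.card T := by exact_mod_cast Fintype.card_pos
  let d : U →ₗᵢ[ℝ] PiLp 2 (fun _ : T => U) :=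
    { toFun := fun u => WithLp.toLp 2 (fun _ => (Real.sqrt (Fintype.card T))⁻¹ • u)
      map_add' := fun x y => by ext t; simp
      map_smul' := fun r x => by ext t; exact smul_comm _ _ _
      norm_map' := fun u => by
        have hp := Real.sqrt_pos.2 hT
        rw [← sq_eq_sq₀ (norm_nonneg _) (norm_nonneg _)]
        simp only [LinearMap.coe_mk, AddHom.coe_mk, PiLp.norm_sq_eq_of_L2]
        simp only [norm_smul, norm_inv, Real.norm_eq_abs, abs_of_pos hp, Finset.sum_const,
          Finset.card_univ, nsmul_eq_mul, mul_pow, inv_pow, Real.sq_sqrt hT.le]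
        field_simp }
  have hd : ∀ g x, d (σ g x) = τ g (d x) := by
    intro g x
    ext t
    simp [d, σ, τ]
  let b := Module.Basis.ofVectorSpace ℝ U
  have hbc : Countable (Module.Basis.ofVectorSpaceIndex ℝ U) := by
    rw [← Cardinal.mk_le_aleph0_iff, b.mk_eq_rank'', hU.rank_eq]
  let b' := Module.Basis.ofVectorSpace ℝ (PiLp 2 (fun _ : T => U))
  have hbc' : Countable (Module.Basis.ofVectorSpaceIndex ℝ (PiLp 2 (fun _ : T => U))) := by
    rw [← Cardinal.mk_le_aleph0_iff, b'.mk_eq_rank'']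
    have := LinearMap.lift_rank_le_of_injective f.toLinearMap f.injective
    rw [hU.rank_eq] at this
    simpa using this
  exact UnivAux.main τ σ hτ hσ (hcop.of_left f hfτ) (hcop.of_right d hd) b' b
    b'.span_eq b.span_eq
end

section
/- Let $G$ be a finite group and let $U$ be a $G$-universe. For every $n \geq 1$, the quotient of the set $\mathscr{L}(\bigoplus_{i=1}^n U,\, U)$ of (not necessarily equivariant) real-linear isometric embeddings by the equivalence relation generated by $f \approx f\circ(a_1\oplus\cdots\oplus a_n)$ for $a_1,\ldots,a_n \in \mathscr{L}(U,U)$ has exactly one element. (Equivalently, the orbit space $\mathscr{L}_U(n)/\mathscr{L}_U(1)^{\times n}$ of the right action of $\mathscr{L}_U(1)^{\times n}$ on $\mathscr{L}_U(n)$ by blockwise precomposition consists of a single point.) -/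
/-- The one-step relation on `𝓛(U^n, U) = 𝓛_U(n)` identifying `f ∘ (a₁ ⊕ ⋯ ⊕ aₙ)`
with `f`, for linear isometric embeddings `a₁, …, aₙ : U → U`.  The quotient
`Quot (blockRel U n)` is the quotient by the equivalence relation it generates, i.e. the
orbit space `𝓛_U(n) / 𝓛_U(1)^{× n}`. -/
def blockRel (U : Type*) [NormedAddCommGroup U] [InnerProductSpace ℝ U] (n : ℕ) :
    (PiLp 2 (fun _ : Fin n => U) →ₗᵢ[ℝ] U) →
      (PiLp 2 (fun _ : Fin n => U) →ₗᵢ[ℝ] U) → Prop :=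
  fun f f' => ∃ a : Fin n → (U →ₗᵢ[ℝ] U),
    ∀ x : PiLp 2 (fun _ : Fin n => U), f' x = f (WithLp.toLp 2 (fun i => a i (x i)))

section Helpers

variable {U : Type*} [NormedAddCommGroup U] [InnerProductSpace ℝ U]

/-- A real inner product space of countably infinite dimension has an orthonormal
algebraic basis indexed by the natural numbers. -/
lemma exists_orthonormal_basis_nat (h : Module.rank ℝ U = Cardinal.aleph0) :
    ∃ b : Module.Basis ℕ ℝ U, Orthonormal ℝ b := by
  have b0 := Module.Basis.ofVectorSpace ℝ U
  have hc := b0.mk_eq_rank''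
  rw [h] at hc
  obtain ⟨hd⟩ := Cardinal.denumerable_iff.2 hc
  let e := Denumerable.eqv (Module.Basis.ofVectorSpaceIndex ℝ U)
  let b1 := b0.reindex e
  refine ⟨Module.Basis.mk
    (InnerProductSpace.gramSchmidtNormed_linearIndependent b1.linearIndependent)
    (((InnerProductSpace.span_gramSchmidtNormed_range (𝕜 := ℝ) b1).trans
      (InnerProductSpace.span_gramSchmidt ℝ b1)).trans b1.span_eq).ge, ?_⟩
  rw [Module.Basis.coe_mk]
  exact InnerProductSpace.gramSchmidtNormed_orthonormal b1.linearIndependent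

/-- An orthonormal basis may be sent isometrically to any orthonormal family. -/
lemma exists_isometry_of_orthonormal {E : Type*} [NormedAddCommGroup E] [InnerProductSpace ℝ E]
    {ι : Type*} (b : Module.Basis ι ℝ U) (hb : Orthonormal ℝ b) (w : ι → E)
    (hw : Orthonormal ℝ w) : ∃ a : U →ₗᵢ[ℝ] E, ∀ k, a (b k) = w k := by
  have key : ⇑(b.constr ℝ w) ∘ ⇑b = w := by
    funext k
    simp
  refine ⟨(b.constr ℝ w).isometryOfOrthonormal hb (by rw [key]; exact hw), fun k => ?_⟩
  simp

/-- Orthogonality of the ranges of two linear maps can be checked on a basis. -/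
lemma inner_eq_zero_of_basis {E ι : Type*} [NormedAddCommGroup E] [InnerProductSpace ℝ E]
    (b : Module.Basis ι ℝ U) (A B : U →ₗ[ℝ] E)
    (h : ∀ k l, inner ℝ (A (b k)) (B (b l)) = (0 : ℝ)) (x y : U) :
    inner ℝ (A x) (B y) = (0 : ℝ) := by
  have h1 : ((innerₗ E).compl₁₂ A B) = 0 := by
    refine b.ext fun k => b.ext fun l => ?_
    simpa using h k l
  simpa using congrArg (fun T => T x y) h1

lemma toLp_eq_sum_single {n : ℕ} (x : PiLp 2 (fun _ : Fin n => U)) :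
    x = ∑ i, PiLp.single 2 i (x i) := by
  ext j
  simp [Pi.single_apply]

/-- Inclusion of a summand. -/
noncomputable def singleLin (U : Type*) [NormedAddCommGroup U] [InnerProductSpace ℝ U] {n : ℕ}
    (i : Fin n) : U →ₗ[ℝ] PiLp 2 (fun _ : Fin n => U) :=
  (WithLp.linearEquiv 2 ℝ (Fin n → U)).symm.toLinearMap ∘ₗ LinearMap.single ℝ (fun _ => U) i

lemma singleLin_apply {n : ℕ} (i : Fin n) (u : U) :
    singleLin U i u = PiLp.single 2 i u := rfl

/-- Blockwise application of a linear map. -/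
noncomputable def blk {n : ℕ} (a : U →ₗ[ℝ] U) :
    PiLp 2 (fun _ : Fin n => U) →ₗ[ℝ] PiLp 2 (fun _ : Fin n => U) where
  toFun x := WithLp.toLp 2 (fun i => a (x i))
  map_add' x y := by ext i; simp
  map_smul' c x := by ext i; simp

/-- Blockwise application of a linear isometry. -/
noncomputable def blkIso {n : ℕ} (a : U →ₗᵢ[ℝ] U) :
    PiLp 2 (fun _ : Fin n => U) →ₗᵢ[ℝ] PiLp 2 (fun _ : Fin n => U) where
  toLinearMap := blk a.toLinearMap
  norm_map' x := by
    simp [blk, PiLp.norm_eq_of_L2]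

lemma rel_comp {n : ℕ} (f : PiLp 2 (fun _ : Fin n => U) →ₗᵢ[ℝ] U) (a : U →ₗᵢ[ℝ] U) :
    Quot.mk (blockRel U n) f = Quot.mk (blockRel U n) (f.comp (blkIso a)) :=
  Quot.sound ⟨fun _ => a, fun _ => rfl⟩

/-- An isometric splitting of `U` into two copies of itself. -/
lemma exists_splitting (b : Module.Basis ℕ ℝ U) (hb : Orthonormal ℝ b) :
    ∃ (p q : U →ₗ[ℝ] U) (i j : U →ₗᵢ[ℝ] U),
      (∀ y, ‖p y‖ ^ 2 + ‖q y‖ ^ 2 = ‖y‖ ^ 2) ∧ (∀ y, p (i y) = y) ∧ (∀ y, q (i y) = 0) ∧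
      (∀ y, p (j y) = 0) ∧ (∀ y, q (j y) = y) := by
  classical
  let e : ℕ ≃ ℕ ⊕ ℕ := Denumerable.equiv₂ _ _
  let c : Module.Basis (ℕ ⊕ ℕ) ℝ U := b.reindex e
  have hc : Orthonormal ℝ c := by
    have : (c : ℕ ⊕ ℕ → U) = b ∘ e.symm := by
      funext k; simp [c]
    rw [this]
    exact hb.comp _ e.symm.injective
  obtain ⟨i, hi⟩ := exists_isometry_of_orthonormal b hb (fun k => c (Sum.inl k))
    (hc.comp _ Sum.inl_injective)
  obtain ⟨j, hj⟩ := exists_isometry_of_orthonormal b hb (fun k => c (Sum.inr k))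
    (hc.comp _ Sum.inr_injective)
  let w : ℕ ⊕ ℕ → WithLp 2 (U × U) := Sum.elim
    (fun k => WithLp.toLp 2 (b k, 0)) (fun k => WithLp.toLp 2 (0, b k))
  have hw : Orthonormal ℝ w := by
    rw [orthonormal_iff_ite] at hb ⊢
    rintro (k | k) (l | l) <;> simp [w, WithLp.prod_inner_apply, hb]
  obtain ⟨P, hP⟩ := exists_isometry_of_orthonormal c hc w hw
  let T := (WithLp.linearEquiv 2 ℝ (U × U)).toLinearMap ∘ₗ P.toLinearMap
  refine ⟨LinearMap.fst ℝ U U ∘ₗ T, LinearMap.snd ℝ U U ∘ₗ T, i, j, fun y => ?_, ?_, ?_, ?_, ?_⟩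
  · rw [← P.norm_map y, WithLp.prod_norm_sq_eq_of_L2]
    rfl
  · intro y
    have : (LinearMap.fst ℝ U U ∘ₗ T) ∘ₗ i.toLinearMap = LinearMap.id :=
      b.ext fun k => by simp [T, hi, hP, w]
    exact congrArg (fun F => F y) this
  · intro y
    have : (LinearMap.snd ℝ U U ∘ₗ T) ∘ₗ i.toLinearMap = 0 :=
      b.ext fun k => by simp [T, hi, hP, w]
    exact congrArg (fun F => F y) this
  · intro y
    have : (LinearMap.fst ℝ U U ∘ₗ T) ∘ₗ j.toLinearMap = 0 :=
      b.ext fun k => by simp [T, hj, hP, w]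
    exact congrArg (fun F => F y) this
  · intro y
    have : (LinearMap.snd ℝ U U ∘ₗ T) ∘ₗ j.toLinearMap = LinearMap.id :=
      b.ext fun k => by simp [T, hj, hP, w]
    exact congrArg (fun F => F y) this

/-- Embeddings with orthogonal images are equivalent. -/
lemma rel_of_orthogonal (b : Module.Basis ℕ ℝ U) (hb : Orthonormal ℝ b) {n : ℕ}
    (f g : PiLp 2 (fun _ : Fin n => U) →ₗᵢ[ℝ] U)
    (h : ∀ x y, inner ℝ (f x) (g y) = (0 : ℝ)) :
    Quot.mk (blockRel U n) f = Quot.mk (blockRel U n) g := by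
  obtain ⟨p, q, i, j, hpq, hpi, hqi, hpj, hqj⟩ := exists_splitting b hb
  let H : PiLp 2 (fun _ : Fin n => U) →ₗᵢ[ℝ] U :=
    { toLinearMap := f.toLinearMap ∘ₗ blk p + g.toLinearMap ∘ₗ blk q
      norm_map' := fun x => by
        have h1 : ‖f (blk p x) + g (blk q x)‖ ^ 2 = ‖x‖ ^ 2 := by
          rw [norm_add_sq_real, h, f.norm_map, g.norm_map, PiLp.norm_sq_eq_of_L2,
            PiLp.norm_sq_eq_of_L2, PiLp.norm_sq_eq_of_L2]
          simp only [mul_zero, add_zero, ← Finset.sum_add_distrib]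
          exact Finset.sum_congr rfl fun k _ => hpq (x k)
        exact (sq_eq_sq₀ (norm_nonneg _) (norm_nonneg _)).1 h1 }
  have hH : ∀ x, H x = f (blk p x) + g (blk q x) := fun _ => rfl
  have hf : H.comp (blkIso i) = f := by
    ext x
    have h1 : blk p (blkIso i x) = x := by
      ext k; exact hpi (x k)
    have h2 : blk q (blkIso i x) = 0 := by
      ext k; exact hqi (x k)
    simp [hH, h1, h2]
  have hg : H.comp (blkIso j) = g := by
    ext x
    have h1 : blk p (blkIso j x) = 0 := by
      ext k; exact hpj (x k)
    have h2 : blk q (blkIso j x) = x := by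
      ext k; exact hqj (x k)
    simp [hH, h1, h2]
  rw [← hf, ← hg, ← rel_comp, ← rel_comp]

/-- A finite set of linear conditions on an infinite-dimensional space has a unit solution. -/
lemma exists_unit_kernel (hU : ¬ FiniteDimensional ℝ U) {ι : Type*} [Finite ι]
    (T : ι → U →ₗ[ℝ] ℝ) : ∃ u : U, ‖u‖ = 1 ∧ ∀ i, T i u = 0 := by
  have h1 : ¬ Function.Injective (LinearMap.pi T) := fun h =>
    hU (FiniteDimensional.of_injective _ h)
  rw [← LinearMap.ker_eq_bot, Submodule.eq_bot_iff] at h1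
  push Not at h1
  obtain ⟨v, hv, hv0⟩ := h1
  refine ⟨‖v‖⁻¹ • v, norm_smul_inv_norm hv0, fun i => ?_⟩
  have : T i v = 0 := congrFun hv i
  simp [this]

/-- Any two embeddings become orthogonal after blockwise precomposition. -/
lemma exists_orthogonal_restrictions (b : Module.Basis ℕ ℝ U) (hb : Orthonormal ℝ b) {n : ℕ}
    (f g : PiLp 2 (fun _ : Fin n => U) →ₗᵢ[ℝ] U) :
    ∃ a c : U →ₗᵢ[ℝ] U, ∀ x y, inner ℝ (f (blkIso a x)) (g (blkIso c y)) = (0 : ℝ) := by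
  have hU : ¬ FiniteDimensional ℝ U := fun _ =>
    not_finite_iff_infinite.2 (inferInstance : Infinite ℕ) (Module.Finite.finite_basis b)
  let F : Fin n → U →ₗ[ℝ] U := fun i => f.toLinearMap ∘ₗ singleLin U i
  let K : Fin n → U →ₗ[ℝ] U := fun i => g.toLinearMap ∘ₗ singleLin U i
  let r : U → U → Prop := fun x y => inner ℝ x y = (0 : ℝ) ∧
    ∀ i j, inner ℝ (F i x) (K j y) = (0 : ℝ) ∧ inner ℝ (F i y) (K j x) = (0 : ℝ)
  have : Std.Symm r := ⟨fun x y h => ⟨by rw [real_inner_comm]; exact h.1,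
    fun i j => ⟨(h.2 i j).2, (h.2 i j).1⟩⟩⟩
  obtain ⟨w, hw1, hw⟩ := exists_seq_of_forall_finset_exists' (fun u : U => ‖u‖ = 1) r (by
    intro s _
    obtain ⟨u, hu, hT⟩ := exists_unit_kernel hU
      (fun t : s ⊕ ((s × Fin n × Fin n) ⊕ (s × Fin n × Fin n)) => match t with
        | Sum.inl x => innerₗ U x.1
        | Sum.inr (Sum.inl (x, i, j)) => innerₗ U (F i x.1) ∘ₗ K j
        | Sum.inr (Sum.inr (x, i, j)) => innerₗ U (K j x.1) ∘ₗ F i)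
    refine ⟨u, hu, fun x hx => ⟨?_, fun i j => ⟨?_, ?_⟩⟩⟩
    · simpa using hT (Sum.inl ⟨x, hx⟩)
    · simpa using hT (Sum.inr (Sum.inl (⟨x, hx⟩, i, j)))
    · rw [real_inner_comm]
      simpa using hT (Sum.inr (Sum.inr (⟨x, hx⟩, i, j))))
  have hwo : Orthonormal ℝ w := ⟨hw1, fun k l hkl => (hw hkl).1⟩
  obtain ⟨a, ha⟩ := exists_isometry_of_orthonormal b hb (fun k => w (2 * k))
    (hwo.comp _ fun k l h => by simpa using h)
  obtain ⟨c, hc⟩ := exists_isometry_of_orthonormal b hb (fun k => w (2 * k + 1))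
    (hwo.comp _ fun k l h => by simpa using h)
  refine ⟨a, c, fun x y => ?_⟩
  rw [toLp_eq_sum_single (blkIso a x), toLp_eq_sum_single (blkIso c y), map_sum, map_sum,
    sum_inner]
  refine Finset.sum_eq_zero fun i _ => ?_
  rw [inner_sum]
  refine Finset.sum_eq_zero fun j _ => ?_
  refine inner_eq_zero_of_basis b (F i ∘ₗ a.toLinearMap) (K j ∘ₗ c.toLinearMap)
    (fun k l => ?_) (x i) (y j)
  have hne : 2 * k ≠ 2 * l + 1 := by omega
  have := ((hw hne).2 i j).1
  simpa [ha, hc] using this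

lemma exists_embedding (b : Module.Basis ℕ ℝ U) (hb : Orthonormal ℝ b) (n : ℕ) :
    Nonempty (PiLp 2 (fun _ : Fin n => U) →ₗᵢ[ℝ] U) := by
  choose s hs using fun i : Fin n => exists_isometry_of_orthonormal b hb
    (fun k => b (Nat.pair i k))
    (hb.comp _ fun k l h => (Nat.pair_eq_pair.1 h).2)
  have ho : OrthogonalFamily ℝ (fun _ : Fin n => U) s := by
    intro i j hij x y
    refine inner_eq_zero_of_basis b (s i).toLinearMap (s j).toLinearMap (fun k l => ?_) x y
    have : Nat.pair i k ≠ Nat.pair j l := fun h =>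
      hij (Fin.ext (Nat.pair_eq_pair.1 h).1)
    simpa [hs] using hb.2 this
  exact ⟨{
    toFun := fun x => ∑ i, s i (x i)
    map_add' := fun x y => by simp [Finset.sum_add_distrib]
    map_smul' := fun c x => by simp [Finset.smul_sum]
    norm_map' := fun x => by
      have h1 := ho.norm_sum (fun i => x i) Finset.univ
      rw [← PiLp.norm_sq_eq_of_L2] at h1
      exact (sq_eq_sq₀ (norm_nonneg _) (norm_nonneg _)).1 h1 }⟩

end Helpers

/-- For a `G`-universe `U` and `n ≥ 1`, the orbit space `𝓛_U(n)/𝓛_U(1)^{× n}` consists of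
a single point. -/
theorem blockRel_quot_unique (G : Type*) [Group G] [Finite G]
    {U : Type*} [NormedAddCommGroup U] [InnerProductSpace ℝ U]
    (ρ : G →* (U ≃ₗᵢ[ℝ] U)) (hU : IsGUniverse G ρ) (n : ℕ) (hn : 1 ≤ n) :
    Nonempty (Quot (blockRel U n)) ∧ Subsingleton (Quot (blockRel U n)) := by
  obtain ⟨b, hb⟩ := exists_orthonormal_basis_nat hU.rank_eq
  refine ⟨(exists_embedding b hb n).map (Quot.mk _), ⟨?_⟩⟩
  rintro ⟨f⟩ ⟨g⟩
  obtain ⟨a, c, hac⟩ := exists_orthogonal_restrictions b hb f g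
  exact (rel_comp f a).trans ((rel_of_orthogonal b hb (f.comp (blkIso a)) (g.comp (blkIso c))
    hac).trans (rel_comp g c).symm)
end

section
/- Let $V$ and $U$ be real inner product spaces of countably infinite dimension and let $S$ be a nonempty finite set. Then the quotient of the set $\mathscr{L}(\bigoplus_{s\in S} V,\, U)$ of real-linear isometric embeddings by the equivalence relation generated by $f \approx f\circ(\bigoplus_{s\in S} a_s)$ for families $(a_s)_{s\in S}$ with $a_s \in \mathscr{L}(V,V)$ has exactly one element. (This computes the underlying set of the orbit space $\mathscr{L}(\mathrm{Ind}_H^G\widehat{U}, U)\,/\,F_H(G,\mathscr{L}_{\widehat{U}}(1))$.) -/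
/-- The one-step relation on `𝓛(⊕_{s ∈ S} V, U)` identifying `f ∘ (⊕_{s ∈ S} a_s)` with
`f`, for families of linear isometric embeddings `a_s : V → V`.  The quotient
`Quot (blockRelS V U S)` is the quotient by the equivalence relation it generates, i.e.
the orbit space `𝓛(⊕_{s ∈ S} V, U) / ∏_{s ∈ S} 𝓛(V, V)`. -/
def blockRelS (V U S : Type*) [NormedAddCommGroup V] [InnerProductSpace ℝ V]
    [NormedAddCommGroup U] [InnerProductSpace ℝ U] [Fintype S] :
    (PiLp 2 (fun _ : S => V) →ₗᵢ[ℝ] U) → (PiLp 2 (fun _ : S => V) →ₗᵢ[ℝ] U) → Prop :=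
  fun f f' => ∃ a : S → (V →ₗᵢ[ℝ] V),
    ∀ x : PiLp 2 (fun _ : S => V), f' x = f (WithLp.toLp 2 (fun s => a s (x s)))

open Module in
theorem exists_onb (V : Type*) [NormedAddCommGroup V] [InnerProductSpace ℝ V]
    (hV : Module.rank ℝ V = Cardinal.aleph0) :
    ∃ e : Basis ℕ ℝ V, Orthonormal ℝ e := by
  have hc : Cardinal.mk (Basis.ofVectorSpaceIndex ℝ V) = Cardinal.aleph0 := by
    rw [← hV]; exact (Basis.ofVectorSpace ℝ V).mk_eq_rank''
  obtain ⟨eqv⟩ := Cardinal.lift_mk_eq'.1 (show Cardinal.lift.{0} (Cardinal.mk (Basis.ofVectorSpaceIndex ℝ V)) =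
      Cardinal.lift (Cardinal.mk ℕ) by simp [hc])
  let b : Basis ℕ ℝ V := (Basis.ofVectorSpace ℝ V).reindex eqv
  have ho := InnerProductSpace.gramSchmidtNormed_orthonormal (𝕜 := ℝ) b.linearIndependent
  refine ⟨Basis.mk ho.linearIndependent ?_, ?_⟩
  · rw [InnerProductSpace.span_gramSchmidtNormed_range, InnerProductSpace.span_gramSchmidt,
      b.span_eq]
  · rw [Basis.coe_mk]; exact ho

open Module in
/-- The basis of the direct sum. -/
noncomputable def sumBasis {V ι : Type*} (S : Type*) [NormedAddCommGroup V]
    [InnerProductSpace ℝ V] [Fintype S] (e : Basis ι ℝ V) :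
    Basis (Σ _ : S, ι) ℝ (PiLp 2 (fun _ : S => V)) :=
  (Pi.basis (fun _ : S => e)).map (WithLp.linearEquiv 2 ℝ (S → V)).symm

open Classical in
theorem inner_single_single {V S : Type*} [NormedAddCommGroup V]
    [InnerProductSpace ℝ V] [Fintype S] (s t : S) (x y : V) :
    inner ℝ (PiLp.single 2 s x : PiLp 2 (fun _ : S => V)) (PiLp.single 2 t y) =
      if s = t then inner ℝ x y else 0 := by
  rw [PiLp.inner_apply, Finset.sum_eq_single s]
  · split_ifs with h
    · subst h; simp
    · simp [h]
  · intro b _ hb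
    simp [hb]
  · simp

open Classical in
theorem sumBasis_apply {V ι : Type*} (S : Type*) [NormedAddCommGroup V]
    [InnerProductSpace ℝ V] [Fintype S] (e : Module.Basis ι ℝ V) (s : S) (n : ι) :
    sumBasis S e ⟨s, n⟩ = PiLp.single 2 s (e n) := by
  simp only [sumBasis, Module.Basis.map_apply, Pi.basis_apply]
  rfl

open Classical in
theorem orthonormal_single {V S ι : Type*} [NormedAddCommGroup V]
    [InnerProductSpace ℝ V] [Fintype S] (v : S → ι → V) (hv : ∀ s, Orthonormal ℝ (v s)) :
    Orthonormal ℝ (fun p : (Σ _ : S, ι) =>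
      (PiLp.single 2 p.1 (v p.1 p.2) : PiLp 2 (fun _ : S => V))) := by
  rw [orthonormal_iff_ite]
  rintro ⟨s, m⟩ ⟨t, n⟩
  rw [inner_single_single]
  by_cases h : s = t
  · subst h
    simp [orthonormal_iff_ite.1 (hv s) m n]
  · simp [h]

theorem sumBasis_orthonormal {V S ι : Type*} [NormedAddCommGroup V]
    [InnerProductSpace ℝ V] [Fintype S] (e : Module.Basis ι ℝ V) (he : Orthonormal ℝ e) :
    Orthonormal ℝ (sumBasis S e) := by
  classical
  have := orthonormal_single (S := S) (fun _ => e) (fun _ => he)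
  convert this with p
  exact sumBasis_apply S e p.1 p.2

open Classical in
theorem exists_isom {V U S ι : Type*} [NormedAddCommGroup V]
    [InnerProductSpace ℝ V] [NormedAddCommGroup U] [InnerProductSpace ℝ U]
    [Fintype S] (e : Module.Basis ι ℝ V) (he : Orthonormal ℝ e)
    (c : (Σ _ : S, ι) → U) (hc : Orthonormal ℝ c) :
    ∃ h : PiLp 2 (fun _ : S => V) →ₗᵢ[ℝ] U, ∀ s n, h (PiLp.single 2 s (e n)) = c ⟨s, n⟩ := by
  refine ⟨((sumBasis S e).constr ℝ c).isometryOfOrthonormal (sumBasis_orthonormal e he) ?_, ?_⟩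
  · convert hc
    ext p; simp
  · intro s n
    rw [← sumBasis_apply]; simp

open Classical in
theorem blockRelS_of_basis {V U S ι : Type*} [NormedAddCommGroup V]
    [InnerProductSpace ℝ V] [NormedAddCommGroup U] [InnerProductSpace ℝ U]
    [Fintype S] (e : Module.Basis ι ℝ V) (he : Orthonormal ℝ e)
    (f f' : PiLp 2 (fun _ : S => V) →ₗᵢ[ℝ] U)
    (v : S → ι → V) (hv : ∀ s, Orthonormal ℝ (v s))
    (hf : ∀ s n, f' (PiLp.single 2 s (e n)) = f (PiLp.single 2 s (v s n))) :
    blockRelS V U S f f' := by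
  let a : S → (V →ₗᵢ[ℝ] V) := fun s =>
    (e.constr ℝ (v s)).isometryOfOrthonormal he (by convert hv s; ext p; simp)
  have ha : ∀ s n, a s (e n) = v s n := by intro s n; simp [a]
  let A : PiLp 2 (fun _ : S => V) →ₗ[ℝ] PiLp 2 (fun _ : S => V) :=
    (WithLp.linearEquiv 2 ℝ (S → V)).symm.toLinearMap ∘ₗ
      (LinearMap.pi fun s => (a s).toLinearMap ∘ₗ LinearMap.proj s) ∘ₗ
      (WithLp.linearEquiv 2 ℝ (S → V)).toLinearMap
  have key : f'.toLinearMap = f.toLinearMap ∘ₗ A := by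
    refine (sumBasis S e).ext ?_
    rintro ⟨s, n⟩
    rw [sumBasis_apply]
    have : A (PiLp.single 2 s (e n)) = PiLp.single 2 s (v s n) := by
      ext t
      change a t ((PiLp.single 2 s (e n) : PiLp 2 (fun _ : S => V)) t) = _
      by_cases h : t = s
      · subst h; simp [ha]
      · simp [h]
    simp [this, hf]
  exact ⟨a, fun x => LinearMap.congr_fun key x⟩

theorem exists_unit {V U : Type*} [NormedAddCommGroup V]
    [InnerProductSpace ℝ V] [NormedAddCommGroup U] [InnerProductSpace ℝ U]
    (hV : Module.rank ℝ V = Cardinal.aleph0) (L : V →ₗ[ℝ] U)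
    (T : Set V) (hT : T.Finite) (T' : Set U) (hT' : T'.Finite) :
    ∃ x : V, ‖x‖ = 1 ∧ (∀ t ∈ T, inner ℝ t x = 0) ∧ ∀ u ∈ T', inner ℝ u (L x) = 0 := by
  have := hT.to_subtype
  have := hT'.to_subtype
  let Φ : V →ₗ[ℝ] ((T → ℝ) × (T' → ℝ)) :=
    LinearMap.prod (LinearMap.pi fun t => (innerₗ V t.1))
      (LinearMap.pi fun u => (innerₗ U u.1) ∘ₗ L)
  have hni : ¬ Function.Injective Φ := by
    intro hi
    have : Module.Finite ℝ V := Module.Finite.of_injective Φ hi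
    exact (Module.rank_lt_aleph0 ℝ V).ne hV
  obtain ⟨x, hx, hx0⟩ : ∃ x, Φ x = 0 ∧ x ≠ 0 := by
    by_contra! h
    exact hni ((injective_iff_map_eq_zero Φ).2 h)
  have h1 := congrArg Prod.fst hx
  have h2 := congrArg Prod.snd hx
  refine ⟨(‖x‖)⁻¹ • x, by simpa using norm_smul_inv_norm (𝕜 := ℝ) hx0, ?_, ?_⟩
  · intro t ht
    have : inner ℝ t x = 0 := congrFun h1 ⟨t, ht⟩
    simp [inner_smul_right, this]
  · intro t ht
    have : inner ℝ t (L x) = 0 := congrFun h2 ⟨t, ht⟩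
    simp [inner_smul_right, this]

open Classical in
/-- The inclusion of a summand, as a linear map. -/
noncomputable def inclS {V S : Type*} [NormedAddCommGroup V]
    [InnerProductSpace ℝ V] [Fintype S] (s : S) : V →ₗ[ℝ] PiLp 2 (fun _ : S => V) :=
  (WithLp.linearEquiv 2 ℝ (S → V)).symm.toLinearMap ∘ₗ LinearMap.single ℝ (fun _ : S => V) s

open Classical in
theorem inclS_apply {V S : Type*} [NormedAddCommGroup V]
    [InnerProductSpace ℝ V] [Fintype S] (s : S) (x : V) :
    inclS s x = (PiLp.single 2 s x : PiLp 2 (fun _ : S => V)) := rfl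

open Classical in
theorem exists_ortho {V U S : Type*} [NormedAddCommGroup V]
    [InnerProductSpace ℝ V] [NormedAddCommGroup U] [InnerProductSpace ℝ U]
    (hV : Module.rank ℝ V = Cardinal.aleph0) [Fintype S]
    (f g : PiLp 2 (fun _ : S => V) →ₗᵢ[ℝ] U) :
    ∃ v w : S → ℕ → V, (∀ s, Orthonormal ℝ (v s)) ∧ (∀ s, Orthonormal ℝ (w s)) ∧
      ∀ s t m n, inner ℝ (f (PiLp.single 2 s (v s m))) (g (PiLp.single 2 t (w t n))) = 0 := by
  obtain ⟨q, hq, hr⟩ := exists_seq_of_forall_finset_exists (α := (S → V) × (S → V))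
    (fun p => (∀ s, ‖p.1 s‖ = 1) ∧ (∀ s, ‖p.2 s‖ = 1) ∧
      ∀ s t, inner ℝ (f (inclS s (p.1 s))) (g (inclS t (p.2 t))) = 0)
    (fun p p' => (∀ s, inner ℝ (p.1 s) (p'.1 s) = 0) ∧ (∀ s, inner ℝ (p.2 s) (p'.2 s) = 0) ∧
      (∀ s t, inner ℝ (f (inclS s (p.1 s))) (g (inclS t (p'.2 t))) = 0) ∧
      (∀ s t, inner ℝ (g (inclS t (p.2 t))) (f (inclS s (p'.1 s))) = 0)) (by
    intro F _
    have h1 : ∀ s : S, ∃ x : V, ‖x‖ = 1 ∧ (∀ p ∈ F, inner ℝ (p.1 s) x = 0) ∧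
        ∀ p ∈ F, ∀ t, inner ℝ (g (inclS t (p.2 t))) (f (inclS s x)) = 0 := by
      intro s
      obtain ⟨x, hx, hx1, hx2⟩ := exists_unit hV (f.toLinearMap ∘ₗ inclS s)
        ((fun p : (S → V) × (S → V) => p.1 s) '' F) (F.finite_toSet.image _)
        ((fun p : ((S → V) × (S → V)) × S => g (inclS p.2 (p.1.2 p.2))) ''
          ((F : Set _) ×ˢ Set.univ)) ((F.finite_toSet.prod Set.finite_univ).image _)
      exact ⟨x, hx, fun p hp => hx1 _ ⟨p, hp, rfl⟩, fun p hp t => hx2 _ ⟨(p, t), by simpa using hp, rfl⟩⟩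
    choose x hx hx1 hx2 using h1
    have h2 : ∀ s : S, ∃ y : V, ‖y‖ = 1 ∧ (∀ p ∈ F, inner ℝ (p.2 s) y = 0) ∧
        (∀ p ∈ F, ∀ t, inner ℝ (f (inclS t (p.1 t))) (g (inclS s y)) = 0) ∧
        ∀ t, inner ℝ (f (inclS t (x t))) (g (inclS s y)) = 0 := by
      intro s
      obtain ⟨y, hy, hy1, hy2⟩ := exists_unit hV (g.toLinearMap ∘ₗ inclS s)
        ((fun p : (S → V) × (S → V) => p.2 s) '' F) (F.finite_toSet.image _)
        ((fun p : ((S → V) × (S → V)) × S => f (inclS p.2 (p.1.1 p.2))) ''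
          ((F : Set _) ×ˢ Set.univ) ∪ Set.range (fun t => f (inclS t (x t))))
        (((F.finite_toSet.prod Set.finite_univ).image _).union (Set.finite_range _))
      exact ⟨y, hy, fun p hp => hy1 _ ⟨p, hp, rfl⟩,
        fun p hp t => hy2 _ (Or.inl ⟨(p, t), by simpa using hp, rfl⟩),
        fun t => hy2 _ (Or.inr ⟨t, rfl⟩)⟩
    choose y hy hy1 hy2 hy3 using h2
    exact ⟨(x, y), ⟨hx, hy, fun s t => hy3 t s⟩, fun p hp =>
      ⟨fun s => hx1 s p hp, fun s => hy1 s p hp, fun s t => hy2 t p hp s,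
        fun s t => hx2 s p hp t⟩⟩)
  refine ⟨fun s n => (q n).1 s, fun s n => (q n).2 s, ?_, ?_, ?_⟩
  · intro s
    refine ⟨fun n => (hq n).1 s, fun m n hmn => ?_⟩
    rcases lt_or_gt_of_ne hmn with h | h
    · exact (hr m n h).1 s
    · rw [real_inner_comm]; exact (hr n m h).1 s
  · intro s
    refine ⟨fun n => (hq n).2.1 s, fun m n hmn => ?_⟩
    rcases lt_or_gt_of_ne hmn with h | h
    · exact (hr m n h).2.1 s
    · rw [real_inner_comm]; exact (hr n m h).2.1 s
  · intro s t m n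
    rcases lt_trichotomy m n with h | h | h
    · exact (hr m n h).2.2.1 s t
    · subst h; exact (hq m).2.2 s t
    · rw [real_inner_comm]; exact (hr n m h).2.2.2 s t

/-- For real inner product spaces `V`, `U` of countably infinite dimension and a nonempty
finite set `S`, the orbit space `𝓛(⊕_{s ∈ S} V, U) / ∏_s 𝓛(V,V)` (the underlying set of
`𝓛(Ind_H^G Û, U) / F_H(G, 𝓛_Û(1))`) consists of a single point. -/
theorem blockRelS_quot_unique (V U S : Type*)
    [NormedAddCommGroup V] [InnerProductSpace ℝ V]
    [NormedAddCommGroup U] [InnerProductSpace ℝ U]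
    (hV : Module.rank ℝ V = Cardinal.aleph0) (hU : Module.rank ℝ U = Cardinal.aleph0)
    [Fintype S] [Nonempty S] :
    Nonempty (Quot (blockRelS V U S)) ∧ Subsingleton (Quot (blockRelS V U S)) := by
  classical
  obtain ⟨e, he⟩ := exists_onb V hV
  obtain ⟨b, hb⟩ := exists_onb U hU
  constructor
  · obtain ⟨j, hj⟩ := exists_injective_nat (Σ _ : S, ℕ)
    obtain ⟨h, -⟩ := exists_isom e he (b ∘ j) (hb.comp j hj)
    exact ⟨Quot.mk _ h⟩
  · refine ⟨fun x y => ?_⟩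
    induction x using Quot.ind with | _ f
    induction y using Quot.ind with | _ g
    obtain ⟨v, w, hv, hw, hvw⟩ := exists_ortho hV f g
    have hfv := (orthonormal_single v hv).comp_linearIsometry f
    have hgw := (orthonormal_single w hw).comp_linearIsometry g
    obtain ⟨f', hf'⟩ := exists_isom e he _ hfv
    obtain ⟨g', hg'⟩ := exists_isom e he _ hgw
    let E := e.reindex (Equiv.natSumNatEquivNat).symm
    have hE : Orthonormal ℝ E := by
      have := he.comp _ (Equiv.natSumNatEquivNat).injective
      convert this
      ext p; simp [E]
    let c : (Σ _ : S, ℕ ⊕ ℕ) → U := fun p => Sum.elim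
      (fun n => f (PiLp.single 2 p.1 (v p.1 n))) (fun n => g (PiLp.single 2 p.1 (w p.1 n))) p.2
    have hc : Orthonormal ℝ c := by
      rw [orthonormal_iff_ite] at hfv hgw ⊢
      rintro ⟨s, m | m⟩ ⟨t, n | n⟩
      · simpa [c] using hfv ⟨s, m⟩ ⟨t, n⟩
      · simpa [c] using hvw s t m n
      · simpa [c, real_inner_comm] using hvw t s n m
      · simpa [c] using hgw ⟨s, m⟩ ⟨t, n⟩
    obtain ⟨h, hh⟩ := exists_isom E hE c hc
    have r1 : blockRelS V U S f f' := blockRelS_of_basis e he f f' v hv hf'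
    have r2 : blockRelS V U S g g' := blockRelS_of_basis e he g g' w hw hg'
    have r3 : blockRelS V U S h f' := blockRelS_of_basis e he h f' (fun _ n => E (Sum.inl n))
      (fun _ => hE.comp _ Sum.inl_injective) (fun s n => by rw [hf', hh]; rfl)
    have r4 : blockRelS V U S h g' := blockRelS_of_basis e he h g' (fun _ n => E (Sum.inr n))
      (fun _ => hE.comp _ Sum.inr_injective) (fun s n => by rw [hg', hh]; rfl)
    rw [Quot.sound r1, ← Quot.sound r3, Quot.sound r4, ← Quot.sound r2]
end

section
/- Let $U$, $W$, and $W'$ be real inner product spaces, and suppose there exist surjective real-linear isometries $W \to U$ and $W' \to U$. Then the map $\mathscr{L}(U\oplus U, U)\times\mathscr{L}(W,U)\times\mathscr{L}(W',U) \to \mathscr{L}(W\oplus W', U)$ sending $(F, f, f')$ to $F\circ(f\oplus f')$ is surjective, and it descends to a bijection from the quotient of $\mathscr{L}(U\oplus U,U)\times\mathscr{L}(W,U)\times\mathscr{L}(W',U)$ by the equivalence relation generated by $(F\circ(a\oplus b),\, f,\, f') \approx (F,\, a\circ f,\, b\circ f')$ for $a, b \in \mathscr{L}(U,U)$, onto $\mathscr{L}(W\oplus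 W', U)$. -/
/-- The one-step relation on `𝓛(U ⊕ U, U) × 𝓛(W, U) × 𝓛(W', U)` identifying
`(F ∘ (a ⊕ b), f, f')` with `(F, a ∘ f, b ∘ f')` for `a, b ∈ 𝓛(U, U)`.  The quotient
`Quot (sumRel U W W')` is the quotient by the equivalence relation it generates. -/
def sumRel (U W W' : Type*)
    [NormedAddCommGroup U] [InnerProductSpace ℝ U]
    [NormedAddCommGroup W] [InnerProductSpace ℝ W]
    [NormedAddCommGroup W'] [InnerProductSpace ℝ W'] :
    ((WithLp 2 (U × U) →ₗᵢ[ℝ] U) × (W →ₗᵢ[ℝ] U) × (W' →ₗᵢ[ℝ] U)) →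
      ((WithLp 2 (U × U) →ₗᵢ[ℝ] U) × (W →ₗᵢ[ℝ] U) × (W' →ₗᵢ[ℝ] U)) → Prop :=
  fun p q => ∃ a b : U →ₗᵢ[ℝ] U,
    (∀ x : WithLp 2 (U × U), p.1 x = q.1 (WithLp.toLp 2 (a x.fst, b x.snd))) ∧
    (∀ w : W, q.2.1 w = a (p.2.1 w)) ∧
    (∀ w' : W', q.2.2 w' = b (p.2.2 w'))

/-- The orthogonal direct sum of two linear isometries. -/
noncomputable def osumMap {A B C D : Type*}
    [NormedAddCommGroup A] [InnerProductSpace ℝ A]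
    [NormedAddCommGroup B] [InnerProductSpace ℝ B]
    [NormedAddCommGroup C] [InnerProductSpace ℝ C]
    [NormedAddCommGroup D] [InnerProductSpace ℝ D]
    (f : A →ₗᵢ[ℝ] C) (g : B →ₗᵢ[ℝ] D) : WithLp 2 (A × B) →ₗᵢ[ℝ] WithLp 2 (C × D) where
  toFun x := WithLp.toLp 2 (f x.fst, g x.snd)
  map_add' x y := by simp [← WithLp.toLp_add]
  map_smul' c x := by simp [← WithLp.toLp_smul]
  norm_map' x := by
    change ‖WithLp.toLp 2 (f x.fst, g x.snd)‖ = ‖x‖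
    simp [WithLp.prod_norm_eq_of_L2]

/-- If `W` and `W'` admit surjective linear isometries onto `U`, then the map
`(F, f, f') ↦ F ∘ (f ⊕ f') : 𝓛(U ⊕ U, U) × 𝓛(W,U) × 𝓛(W',U) → 𝓛(W ⊕ W', U)` is
surjective and descends to a bijection on the quotient by the relation
`(F ∘ (a ⊕ b), f, f') ≈ (F, a ∘ f, b ∘ f')`. -/
theorem sumRel_quot_bijective {U W W' : Type*}
    [NormedAddCommGroup U] [InnerProductSpace ℝ U]
    [NormedAddCommGroup W] [InnerProductSpace ℝ W]
    [NormedAddCommGroup W'] [InnerProductSpace ℝ W']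
    (hW : Nonempty (W ≃ₗᵢ[ℝ] U)) (hW' : Nonempty (W' ≃ₗᵢ[ℝ] U)) :
    ∃ Φ : ((WithLp 2 (U × U) →ₗᵢ[ℝ] U) × (W →ₗᵢ[ℝ] U) × (W' →ₗᵢ[ℝ] U)) →
        (WithLp 2 (W × W') →ₗᵢ[ℝ] U),
      (∀ (F : WithLp 2 (U × U) →ₗᵢ[ℝ] U) (f : W →ₗᵢ[ℝ] U) (f' : W' →ₗᵢ[ℝ] U)
          (x : WithLp 2 (W × W')),
        Φ (F, f, f') x = F (WithLp.toLp 2 (f x.fst, f' x.snd))) ∧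
      Function.Surjective Φ ∧
      ∃ Φbar : Quot (sumRel U W W') → (WithLp 2 (W × W') →ₗᵢ[ℝ] U),
        (∀ p, Φbar (Quot.mk _ p) = Φ p) ∧ Function.Bijective Φbar := by
  obtain ⟨e⟩ := hW
  obtain ⟨e'⟩ := hW'
  have key : ∀ (F : WithLp 2 (U × U) →ₗᵢ[ℝ] U) (f : W →ₗᵢ[ℝ] U) (f' : W' →ₗᵢ[ℝ] U)
      (G : WithLp 2 (U × U) →ₗᵢ[ℝ] U),
      G = (F.comp (osumMap f f')).comp
        (osumMap e.symm.toLinearIsometry e'.symm.toLinearIsometry) →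
      Quot.mk (sumRel U W W') (G, e.toLinearIsometry, e'.toLinearIsometry)
        = Quot.mk (sumRel U W W') (F, f, f') := by
    rintro F f f' G rfl
    apply Quot.sound
    refine ⟨f.comp e.symm.toLinearIsometry, f'.comp e'.symm.toLinearIsometry,
      fun x => rfl, fun w => ?_, fun w => ?_⟩ <;> simp
  have hs : Function.Surjective (fun p : (WithLp 2 (U × U) →ₗᵢ[ℝ] U) × (W →ₗᵢ[ℝ] U) ×
      (W' →ₗᵢ[ℝ] U) => p.1.comp (osumMap p.2.1 p.2.2)) := by
    intro G
    refine ⟨(G.comp (osumMap e.symm.toLinearIsometry e'.symm.toLinearIsometry),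
      e.toLinearIsometry, e'.toLinearIsometry), ?_⟩
    ext x
    change G (WithLp.toLp 2 (e.symm (e x.fst), e'.symm (e' x.snd))) = G x
    simp only [LinearIsometryEquiv.symm_apply_apply]
    rfl
  refine ⟨fun p => p.1.comp (osumMap p.2.1 p.2.2), fun F f f' x => rfl, hs,
    Quot.lift (fun p => p.1.comp (osumMap p.2.1 p.2.2)) ?_, fun p => rfl, ?_, ?_⟩
  · rintro ⟨F, f, f'⟩ ⟨G, g, g'⟩ ⟨a, b, h1, h2, h3⟩
    ext x
    change F (WithLp.toLp 2 (f x.fst, f' x.snd)) = G (WithLp.toLp 2 (g x.fst, g' x.snd))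
    simp only at h1 h2 h3
    rw [h1, h2, h3]
    rfl
  · rintro ⟨F, f, f'⟩ ⟨G, g, g'⟩ h
    have h' : F.comp (osumMap f f') = G.comp (osumMap g g') := h
    exact (key F f f' _ rfl).symm.trans (key G g g' _ (by rw [h']))
  · intro G
    obtain ⟨p, hp⟩ := hs G
    exact ⟨Quot.mk _ p, hp⟩
end

section
/- Let $V$ and $U$ be real inner product spaces, let $T$ be a nonempty finite set, and suppose there exists a surjective real-linear isometry $V\oplus V \to V$. Set $W = \bigoplus_{t\in T} V$ and identify $W\oplus W$ with $\bigoplus_{t\in T}(V\oplus V)$ via the canonical shuffle isometry. Then the map $\mathscr{L}(W,U)\times\prod_{t\in T}\mathscr{L}(V\oplus V, V) \to \mathscr{L}(W\oplus W, U)$ sending $(f, (g_t)_{t\in T})$ to $f\circ(\bigoplus_{t\in T} g_t)$ is surjective, and it descends to a bijection from the quotient of $\mathscr{L}(W,U)\times\prod_{t\in T}\mathscr{L}(V\oplus V,V)$ by the equivalence relation generated by $(f\circ(\bigoplus_{t} a_t),\, (g_t)_t) \approx (f,\, (a_t\circ g_t)_t)$ for families $(a_t)_{t\in T}$ with $a_t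 \in \mathscr{L}(V,V)$, onto $\mathscr{L}(W\oplus W, U)$. -/
/-- The one-step relation on `𝓛(W, U) × ∏_{t ∈ T} 𝓛(V ⊕ V, V)` (where `W = ⊕_{t ∈ T} V`)
identifying `(f ∘ (⊕_t a_t), (g_t)_t)` with `(f, (a_t ∘ g_t)_t)` for families
`a_t ∈ 𝓛(V, V)`.  The quotient `Quot (pointwiseSumRel V U T)` is the quotient by the
equivalence relation it generates. -/
def pointwiseSumRel (V U : Type*) (T : Type*) [Fintype T]
    [NormedAddCommGroup V] [InnerProductSpace ℝ V]
    [NormedAddCommGroup U] [InnerProductSpace ℝ U] :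
    ((PiLp 2 (fun _ : T => V) →ₗᵢ[ℝ] U) × (T → (WithLp 2 (V × V) →ₗᵢ[ℝ] V))) →
      ((PiLp 2 (fun _ : T => V) →ₗᵢ[ℝ] U) × (T → (WithLp 2 (V × V) →ₗᵢ[ℝ] V))) → Prop :=
  fun p q => ∃ a : T → (V →ₗᵢ[ℝ] V),
    (∀ x : PiLp 2 (fun _ : T => V), p.1 x = q.1 (WithLp.toLp 2 (fun t => a t (x t)))) ∧
    (∀ (t : T) (y : WithLp 2 (V × V)), q.2 t y = a t (p.2 t y))

/-- The isometry `W ⊕ W → W` given by the shuffle followed by `⊕_t g_t`. -/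
noncomputable def shuffleSum {V : Type*} {T : Type*} [Fintype T]
    [NormedAddCommGroup V] [InnerProductSpace ℝ V] (g : T → (WithLp 2 (V × V) →ₗᵢ[ℝ] V)) :
    WithLp 2 ((PiLp 2 (fun _ : T => V)) × (PiLp 2 (fun _ : T => V))) →ₗᵢ[ℝ]
      PiLp 2 (fun _ : T => V) where
  toFun x := WithLp.toLp 2 (fun t => g t (WithLp.toLp 2 (x.ofLp.1 t, x.ofLp.2 t)))
  map_add' x y := by
    ext t
    simp [← map_add, ← WithLp.toLp_add]
  map_smul' c x := by
    ext t
    simp [← map_smul, ← WithLp.toLp_smul]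
  norm_map' x := by
    rw [← sq_eq_sq₀ (norm_nonneg _) (norm_nonneg _)]
    simp [PiLp.norm_sq_eq_of_L2, WithLp.prod_norm_sq_eq_of_L2, Finset.sum_add_distrib]

/-- The isometry `W → W ⊕ W` given by `⊕_t b_t` followed by the inverse shuffle. -/
noncomputable def unshuffleSum {V : Type*} {T : Type*} [Fintype T]
    [NormedAddCommGroup V] [InnerProductSpace ℝ V] (b : V →ₗᵢ[ℝ] WithLp 2 (V × V)) :
    PiLp 2 (fun _ : T => V) →ₗᵢ[ℝ]
      WithLp 2 ((PiLp 2 (fun _ : T => V)) × (PiLp 2 (fun _ : T => V))) where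
  toFun x := WithLp.toLp 2 (WithLp.toLp 2 (fun t => (b (x t)).ofLp.1),
    WithLp.toLp 2 (fun t => (b (x t)).ofLp.2))
  map_add' x y := by
    apply WithLp.ofLp_injective
    ext t <;> simp
  map_smul' c x := by
    apply WithLp.ofLp_injective
    ext t <;> simp
  norm_map' x := by
    rw [← sq_eq_sq₀ (norm_nonneg _) (norm_nonneg _)]
    have h : ∀ v, ‖(b v).fst‖ ^ 2 + ‖(b v).snd‖ ^ 2 = ‖v‖ ^ 2 := fun v => by
      rw [← b.norm_map v, WithLp.prod_norm_sq_eq_of_L2]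
    simp [PiLp.norm_sq_eq_of_L2, WithLp.prod_norm_sq_eq_of_L2, ← Finset.sum_add_distrib, h]

/-- Let `W = ⊕_{t ∈ T} V` for a nonempty finite set `T`, and suppose there is a surjective
linear isometry `V ⊕ V → V`.  Identifying `W ⊕ W ≅ ⊕_{t ∈ T} (V ⊕ V)` via the shuffle, the
map `(f, (g_t)_t) ↦ f ∘ (⊕_t g_t) : 𝓛(W,U) × ∏_t 𝓛(V ⊕ V, V) → 𝓛(W ⊕ W, U)` is surjective
and descends to a bijection on the quotient by the relation
`(f ∘ (⊕_t a_t), (g_t)_t) ≈ (f, (a_t ∘ g_t)_t)`. -/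
theorem pointwiseSumRel_quot_bijective {V U : Type*}
    [NormedAddCommGroup V] [InnerProductSpace ℝ V]
    [NormedAddCommGroup U] [InnerProductSpace ℝ U]
    (T : Type*) [Fintype T] [Nonempty T]
    (hV : Nonempty (WithLp 2 (V × V) ≃ₗᵢ[ℝ] V)) :
    ∃ Φ : ((PiLp 2 (fun _ : T => V) →ₗᵢ[ℝ] U) × (T → (WithLp 2 (V × V) →ₗᵢ[ℝ] V))) →
        (WithLp 2 ((PiLp 2 (fun _ : T => V)) × (PiLp 2 (fun _ : T => V))) →ₗᵢ[ℝ] U),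
      (∀ (f : PiLp 2 (fun _ : T => V) →ₗᵢ[ℝ] U) (g : T → (WithLp 2 (V × V) →ₗᵢ[ℝ] V))
          (x : WithLp 2 ((PiLp 2 (fun _ : T => V)) × (PiLp 2 (fun _ : T => V)))),
        Φ (f, g) x = f (WithLp.toLp 2 (fun t => g t (WithLp.toLp 2 (x.ofLp.1 t, x.ofLp.2 t))))) ∧
      Function.Surjective Φ ∧
      ∃ Φbar : Quot (pointwiseSumRel V U T) →
          (WithLp 2 ((PiLp 2 (fun _ : T => V)) × (PiLp 2 (fun _ : T => V))) →ₗᵢ[ℝ] U),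
        (∀ p, Φbar (Quot.mk _ p) = Φ p) ∧ Function.Bijective Φbar := by
  obtain ⟨e⟩ := hV
  let Φ : ((PiLp 2 (fun _ : T => V) →ₗᵢ[ℝ] U) × (T → (WithLp 2 (V × V) →ₗᵢ[ℝ] V))) →
        (WithLp 2 ((PiLp 2 (fun _ : T => V)) × (PiLp 2 (fun _ : T => V))) →ₗᵢ[ℝ] U) :=
    fun p => p.1.comp (shuffleSum p.2)
  have hΦ : ∀ (f : PiLp 2 (fun _ : T => V) →ₗᵢ[ℝ] U) (g : T → (WithLp 2 (V × V) →ₗᵢ[ℝ] V))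
      (x : WithLp 2 ((PiLp 2 (fun _ : T => V)) × (PiLp 2 (fun _ : T => V)))),
      Φ (f, g) x = f (WithLp.toLp 2 (fun t => g t (WithLp.toLp 2 (x.ofLp.1 t, x.ofLp.2 t)))) :=
    fun f g x => rfl
  let S : PiLp 2 (fun _ : T => V) →ₗᵢ[ℝ]
      WithLp 2 ((PiLp 2 (fun _ : T => V)) × (PiLp 2 (fun _ : T => V))) :=
    unshuffleSum e.symm.toLinearIsometry
  have hS : ∀ x t, WithLp.toLp 2 ((S x).ofLp.1 t, (S x).ofLp.2 t) = e.symm (x t) :=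
    fun x t => rfl
  have hsurj : Function.Surjective Φ := by
    intro h
    refine ⟨(h.comp S, fun _ => e.toLinearIsometry), ?_⟩
    ext x
    rw [hΦ]
    change h (S _) = h x
    congr 1
    apply WithLp.ofLp_injective
    ext t <;> simp [S, unshuffleSum]
  have hresp : ∀ p q, pointwiseSumRel V U T p q → Φ p = Φ q := by
    rintro ⟨f, g⟩ ⟨f', g'⟩ ⟨a, h1, h2⟩
    ext x
    rw [hΦ, hΦ]
    dsimp only at h1 h2
    rw [h1]
    simp only [h2]
  refine ⟨Φ, hΦ, hsurj, Quot.lift Φ hresp, fun p => rfl, ?_, ?_⟩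
  · have key : ∀ p, Quot.mk (pointwiseSumRel V U T) p =
        Quot.mk _ ((Φ p).comp S, fun _ => e.toLinearIsometry) := by
      rintro ⟨f, g⟩
      symm
      apply Quot.sound
      refine ⟨fun t => (g t).comp e.symm.toLinearIsometry, ?_, ?_⟩
      · intro x
        rfl
      · intro t y
        simp
    rintro ⟨p⟩ ⟨q⟩ h
    have h' : Φ p = Φ q := h
    rw [key p, key q, h']
  · intro h
    obtain ⟨p, hp⟩ := hsurj h
    exact ⟨Quot.mk _ p, hp⟩
end
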